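/- Fix ε ∈ (0, 1/2) and δ ∈ [1/2, 1). If a discrimination procedure D = (D_n) is asymptotically correct for the class of all stationary ergodic binary processes, then there exists a stationary ergodic binary process ρ such that, for two sequences x and y generated independently, each with distribution ρ, the sequence a_n := E[D_n((x_1,…,x_n),(y_1,…,y_n))] satisfies liminf_{n→∞} a_n ≤ ε + (1 − δ²) and limsup_{n→∞} a_n ≥ (δ² − ε)/2; in particular the sequence a_n does not converge to 0. -/

import Mathlib

open scoped Classical

open MeasureTheory

/-- Binary sequences: the sample space of a binary process. -/
abbrev BinSeq : Type := ℕ → Bool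

/-- The shift map on one-way infinite sequences. -/
def shift {α : Type*} : (ℕ → α) → (ℕ → α) := fun x n => x (n + 1)

/-- Expected output of the discrimination procedure `D` at time `n`, when the two
sample sequences are generated independently with distributions `ρx` and `ρy`. -/
noncomputable def expD (D : ∀ n : ℕ, (Fin n → Bool) → (Fin n → Bool) → Bool)
    (ρx ρy : Measure BinSeq) (n : ℕ) : ℝ :=
  ∫ z : BinSeq × BinSeq,
    (if D n (fun i => z.1 ↑i) (fun i => z.2 ↑i) then (1 : ℝ) else 0) ∂(ρx.prod ρy)

open Filter Topology

lemma measurable_shift : Measurable (shift : BinSeq → BinSeq) := by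
  unfold shift
  fun_prop

/-- The output of `D n` on the initial segments of `w` and `v`, as a real number. -/
noncomputable def outputValue (D : ∀ n : ℕ, (Fin n → Bool) → (Fin n → Bool) → Bool)
    (n : ℕ) (w v : BinSeq) : ℝ :=
  if D n (fun i => w ↑i) (fun i => v ↑i) then 1 else 0

section outputValue

variable (D : ∀ n : ℕ, (Fin n → Bool) → (Fin n → Bool) → Bool) (n : ℕ)

lemma outputValue_nonneg (w v : BinSeq) : 0 ≤ outputValue D n w v := by
  unfold outputValue
  split_ifs <;> norm_num

lemma outputValue_le_one (w v : BinSeq) : outputValue D n w v ≤ 1 := by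
  unfold outputValue
  split_ifs <;> norm_num

lemma norm_outputValue_le_one (w v : BinSeq) : ‖outputValue D n w v‖ ≤ 1 := by
  rw [Real.norm_of_nonneg (outputValue_nonneg D n w v)]
  exact outputValue_le_one D n w v

lemma outputValue_eq_comp :
    (fun z : BinSeq × BinSeq => outputValue D n z.1 z.2) =
      (fun p : (Fin n → Bool) × (Fin n → Bool) => if D n p.1 p.2 then (1 : ℝ) else 0) ∘
        fun z : BinSeq × BinSeq => (fun i : Fin n => z.1 i, fun i : Fin n => z.2 i) := rfl

lemma measurable_outputValue :
    Measurable fun z : BinSeq × BinSeq => outputValue D n z.1 z.2 := by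
  rw [outputValue_eq_comp]
  exact (measurable_of_countable _).comp (by fun_prop)

lemma integrable_outputValue (μ : Measure (BinSeq × BinSeq)) [IsFiniteMeasure μ] :
    Integrable (fun z : BinSeq × BinSeq => outputValue D n z.1 z.2) μ :=
  .of_bound (measurable_outputValue D n).aestronglyMeasurable 1
    (.of_forall fun _ => norm_outputValue_le_one D n _ _)

lemma expD_eq_integral (ρ σ : Measure BinSeq) :
    expD D ρ σ n = ∫ z : BinSeq × BinSeq, outputValue D n z.1 z.2 ∂(ρ.prod σ) := rfl

end outputValue

/-- The uniform distribution on the first `q` shifts of `w`. -/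
noncomputable def orbitMeasure (q : ℕ) (w : BinSeq) : Measure BinSeq :=
  (q : ENNReal)⁻¹ • ∑ j ∈ Finset.range q, Measure.dirac (shift^[j] w)

section orbitMeasure

variable {q : ℕ} {w : BinSeq}

lemma isProbabilityMeasure_orbitMeasure (hq : q ≠ 0) (w : BinSeq) :
    IsProbabilityMeasure (orbitMeasure q w) := by
  constructor
  simp only [orbitMeasure, Measure.smul_apply, Measure.finsetSum_apply, measure_univ,
    Finset.sum_const, Finset.card_range, smul_eq_mul, nsmul_eq_mul, mul_one]
  exact ENNReal.inv_mul_cancel (by simpa using hq) (by simp)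

lemma ergodic_orbitMeasure (h : shift^[q] w = w) : Ergodic shift (orbitMeasure q w) := by
  refine ⟨⟨measurable_shift, ?_⟩, ⟨fun s hs hinv => ?_⟩⟩
  · unfold orbitMeasure
    rw [Measure.map_smul, Measure.map_finset_sum measurable_shift.aemeasurable]
    congr 1
    simp only [Measure.map_dirac' measurable_shift, ← Function.iterate_succ_apply']
    have h1 := Finset.sum_range_succ (fun j => Measure.dirac (shift^[j] w)) q
    have h2 := Finset.sum_range_succ' (fun j => Measure.dirac (shift^[j] w)) q
    rw [h2, h] at h1
    ext t ht
    have h3 := congrArg (fun μ : Measure BinSeq => μ t) h1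
    simp only [Measure.add_apply, Function.iterate_zero, id] at h3
    exact (ENNReal.add_left_inj (measure_ne_top _ _)).1 h3
  · have hmem : ∀ j, shift^[j] w ∈ s ↔ w ∈ s := by
      intro j
      induction j with
      | zero => rfl
      | succ j ih =>
        rw [Function.iterate_succ_apply', ← ih]
        exact Set.ext_iff.1 hinv _
    rw [eventuallyConst_set]
    by_cases hw : w ∈ s
    · left
      change orbitMeasure q w sᶜ = 0
      simp [orbitMeasure, hs.compl, hmem, hw]
    · right
      change orbitMeasure q w {x | ¬ x ∉ s} = 0
      simp [orbitMeasure, hs, hmem, hw]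

lemma integral_orbitMeasure (q : ℕ) (w : BinSeq) (f : BinSeq → ℝ) (hf : Measurable f) {C : ℝ}
    (hC : ∀ x, ‖f x‖ ≤ C) :
    ∫ x, f x ∂(orbitMeasure q w) = (q : ℝ)⁻¹ * ∑ j ∈ Finset.range q, f (shift^[j] w) := by
  unfold orbitMeasure
  rw [integral_smul_measure, integral_finsetSum_measure]
  · simp [integral_dirac]
  · exact fun i _ => .of_bound hf.aestronglyMeasurable C (.of_forall hC)

lemma expD_orbitMeasure (D : ∀ n : ℕ, (Fin n → Bool) → (Fin n → Bool) → Bool) (n : ℕ)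
    (hq : q ≠ 0) (w v : BinSeq) :
    expD D (orbitMeasure q w) (orbitMeasure q v) n =
      (q : ℝ)⁻¹ * ∑ i ∈ Finset.range q, (q : ℝ)⁻¹ * ∑ j ∈ Finset.range q,
        outputValue D n (shift^[i] w) (shift^[j] v) := by
  have := isProbabilityMeasure_orbitMeasure hq w
  have := isProbabilityMeasure_orbitMeasure hq v
  have hin : ∀ x, ∫ y, outputValue D n x y ∂(orbitMeasure q v) =
      (q : ℝ)⁻¹ * ∑ j ∈ Finset.range q, outputValue D n x (shift^[j] v) := fun x =>
    integral_orbitMeasure q v _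
      ((measurable_outputValue D n).comp (measurable_const.prodMk measurable_id))
      (norm_outputValue_le_one D n x)
  rw [expD_eq_integral, integral_prod _ (integrable_outputValue D n _)]
  rw [integral_orbitMeasure q w (C := 1)]
  · simp only [hin]
  · exact (measurable_outputValue D n).stronglyMeasurable.integral_prod_right'.measurable
  · intro x
    refine (norm_integral_le_of_norm_le_const
      (.of_forall (norm_outputValue_le_one D n x))).trans ?_
    simp

end orbitMeasure

/-- The coding of the circle by the half circle `[0, 1/2)`. -/
noncomputable def halfCode (x : UnitAddCircle) : Bool :=
  decide ((AddCircle.equivIco (1 : ℝ) 0 x : ℝ) < 1 / 2)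

lemma measurable_halfCode : Measurable halfCode := by
  have h : Measurable fun x : UnitAddCircle => (AddCircle.equivIco (1 : ℝ) 0 x : ℝ) :=
    measurable_subtype_coe.comp (AddCircle.measurableEquivIco (1 : ℝ) 0).measurable
  refine measurable_to_bool ?_
  have : halfCode ⁻¹' {true} = {x | (AddCircle.equivIco (1 : ℝ) 0 x : ℝ) < 1 / 2} := by
    ext x
    simp [halfCode]
  rw [this]
  exact measurableSet_lt h measurable_const

lemma halfCode_coe_of_mem {b : ℝ} (hb : b ∈ Set.Ico (0 : ℝ) 1) :
    halfCode (b : UnitAddCircle) = decide (b < 1 / 2) := by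
  unfold halfCode
  rw [AddCircle.equivIco_coe_of_mem (by simpa using hb)]

lemma halfCode_add_half (x : UnitAddCircle) :
    halfCode (x + ((1 / 2 : ℝ) : UnitAddCircle)) = !halfCode x := by
  obtain ⟨b, hb, rfl⟩ := AddCircle.eq_coe_Ico x
  rw [halfCode_coe_of_mem hb]
  obtain ⟨h0, h1⟩ := hb
  by_cases h : b < 1 / 2
  · rw [← AddCircle.coe_add, halfCode_coe_of_mem ⟨by linarith, by linarith⟩,
      decide_eq_true h, decide_eq_false (by linarith), Bool.not_true]
  · have : ((b : UnitAddCircle) + ((1 / 2 : ℝ) : UnitAddCircle)) =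
        ((b - 1 / 2 : ℝ) : UnitAddCircle) := by
      rw [← AddCircle.coe_add, ← sub_eq_zero, ← AddCircle.coe_sub]
      rw [show b + 1 / 2 - (b - 1 / 2) = 1 by ring]
      exact AddCircle.coe_period 1
    rw [this, halfCode_coe_of_mem ⟨by linarith, by linarith⟩,
      decide_eq_false h, decide_eq_true (by linarith), Bool.not_false]

lemma continuousAt_halfCode {x : UnitAddCircle} (h0 : x ≠ 0)
    (h1 : x ≠ ((1 / 2 : ℝ) : UnitAddCircle)) : ContinuousAt halfCode x := by
  have hc : ContinuousAt (fun x : UnitAddCircle => (AddCircle.equivIco (1 : ℝ) 0 x : ℝ)) x :=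
    continuousAt_subtype_val.comp (AddCircle.continuousAt_equivIco 1 0 (by simpa using h0))
  have hne : (AddCircle.equivIco (1 : ℝ) 0 x : ℝ) ≠ 1 / 2 := fun h =>
    h1 (by rw [← h]; exact AddCircle.coe_equivIco.symm)
  have : halfCode =ᶠ[𝓝 x] fun _ => halfCode x := by
    rcases lt_or_gt_of_ne hne with h | h
    · filter_upwards [hc.eventually_lt_const h] with y hy
      simp [halfCode, hy, h, - one_div]
    · filter_upwards [hc.eventually_const_lt h] with y hy
      simp [halfCode, not_lt.2 hy.le, not_lt.2 h.le, - one_div]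
  exact continuousAt_const.congr this.symm

/-- The coded orbit of `x` under the rotation of the circle by `a`. -/
noncomputable def itinerary (a x : UnitAddCircle) : BinSeq := fun n => halfCode (x + n • a)

/-- The law of the coded orbit of a uniformly distributed point. -/
noncomputable def rotationMeasure (a : UnitAddCircle) : Measure BinSeq :=
  Measure.map (itinerary a) volume

section rotation

variable {a : UnitAddCircle}

lemma measurable_itinerary (a : UnitAddCircle) : Measurable (itinerary a) :=
  measurable_pi_lambda _ fun _ => measurable_halfCode.comp (measurable_id.add_const _)

lemma semiconj_itinerary (a : UnitAddCircle) :
    Function.Semiconj (itinerary a) (· + a) shift := by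
  intro x
  funext n
  simp only [itinerary, shift, succ_nsmul']
  rw [add_assoc]

lemma shift_iterate_itinerary (a x : UnitAddCircle) (j : ℕ) :
    shift^[j] (itinerary a x) = itinerary a (x + j • a) := by
  rw [← (semiconj_itinerary a).iterate_right j x]
  simp

instance isProbabilityMeasure_volume_unitAddCircle :
    IsProbabilityMeasure (volume : Measure UnitAddCircle) :=
  ⟨UnitAddCircle.measure_univ⟩

instance isProbabilityMeasure_rotationMeasure (a : UnitAddCircle) :
    IsProbabilityMeasure (rotationMeasure a) :=
  Measure.isProbabilityMeasure_map (measurable_itinerary a).aemeasurable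

lemma ergodic_rotationMeasure (ha : addOrderOf a = 0) : Ergodic shift (rotationMeasure a) :=
  ((measurable_itinerary a).measurePreserving volume).ergodic_of_ergodic_semiconj
    (AddCircle.ergodic_add_right.2 ha) measurable_shift (semiconj_itinerary a)

lemma orbitMeasure_itinerary_ne {q : ℕ} (hq : Odd q) (a x : UnitAddCircle) :
    orbitMeasure q (itinerary a x) ≠
      orbitMeasure q (itinerary a (x + ((1 / 2 : ℝ) : UnitAddCircle))) := by
  intro h
  have hf : Measurable fun w : BinSeq => if w 0 then (1 : ℝ) else 0 :=
    (measurable_of_countable (fun b : Bool => if b then (1 : ℝ) else 0)).comp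
      (measurable_pi_apply 0)
  have hC : ∀ w : BinSeq, ‖if w 0 then (1 : ℝ) else 0‖ ≤ 1 := fun w => by
    split_ifs <;> simp
  have h1 := congrArg (fun μ : Measure BinSeq => ∫ w, (if w 0 then (1 : ℝ) else 0) ∂μ) h
  simp only [integral_orbitMeasure q _ _ hf hC, shift_iterate_itinerary] at h1
  have hq0 : (q : ℝ)⁻¹ ≠ 0 := by
    have := hq.pos
    positivity
  replace h1 := mul_left_cancel₀ hq0 h1
  have h2 : ∀ j : ℕ, (if itinerary a (x + ((1 / 2 : ℝ) : UnitAddCircle) + j • a) 0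
      then (1 : ℝ) else 0) = 1 - if itinerary a (x + j • a) 0 then (1 : ℝ) else 0 := by
    intro j
    rw [add_right_comm]
    simp only [itinerary, zero_smul, add_zero, halfCode_add_half]
    cases halfCode (x + j • a) <;> simp
  simp only [h2, Finset.sum_sub_distrib, Finset.sum_const, Finset.card_range,
    Finset.sum_boole, nsmul_eq_mul, mul_one] at h1
  obtain ⟨k, rfl⟩ := hq
  rw [eq_sub_iff_add_eq] at h1
  norm_cast at h1
  omega

lemma volume_singleton_unitAddCircle (x : UnitAddCircle) :
    volume ({x} : Set UnitAddCircle) = 0 := by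
  rw [← Metric.closedBall_zero, AddCircle.volume_closedBall]
  simp

variable (D : ∀ n : ℕ, (Fin n → Bool) → (Fin n → Bool) → Bool) (n : ℕ)

lemma measurable_outputValue_itinerary (a : UnitAddCircle) :
    Measurable fun z : UnitAddCircle × UnitAddCircle =>
      outputValue D n (itinerary a z.1) (itinerary a z.2) :=
  (measurable_outputValue D n).comp
    (((measurable_itinerary a).comp measurable_fst).prodMk
      ((measurable_itinerary a).comp measurable_snd))

lemma expD_rotationMeasure (a : UnitAddCircle) :
    expD D (rotationMeasure a) (rotationMeasure a) n =
      ∫ z : UnitAddCircle × UnitAddCircle,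
        outputValue D n (itinerary a z.1) (itinerary a z.2) := by
  rw [expD_eq_integral, rotationMeasure,
    Measure.map_prod_map _ _ (measurable_itinerary a) (measurable_itinerary a),
    integral_map ((measurable_itinerary a).prodMap (measurable_itinerary a)).aemeasurable
      (measurable_outputValue D n).aestronglyMeasurable]
  rfl

lemma continuous_expD_rotationMeasure :
    Continuous fun a => expD D (rotationMeasure a) (rotationMeasure a) n := by
  simp only [expD_rotationMeasure]
  refine continuous_iff_continuousAt.2 fun a => ?_
  refine continuousAt_of_dominated (bound := fun _ => 1)
    (.of_forall fun b => (measurable_outputValue_itinerary D n b).aestronglyMeasurable)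
    (.of_forall fun b => .of_forall fun z => norm_outputValue_le_one D n _ _)
    (integrable_const _) ?_
  have hae : ∀ᵐ x : UnitAddCircle, ∀ k : ℕ,
      x + k • a ≠ 0 ∧ x + k • a ≠ ((1 / 2 : ℝ) : UnitAddCircle) := by
    refine ae_all_iff.2 fun k => ?_
    have hne : ∀ c : UnitAddCircle, ∀ᵐ x : UnitAddCircle, x + k • a ≠ c := fun c => by
      filter_upwards [compl_mem_ae_iff.2 (volume_singleton_unitAddCircle (c - k • a))]
        with x hx h
      exact hx (eq_sub_of_add_eq h)
    exact (hne _).and (hne _)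
  have hseg : ∀ x : UnitAddCircle,
      (∀ k : ℕ, x + k • a ≠ 0 ∧ x + k • a ≠ ((1 / 2 : ℝ) : UnitAddCircle)) →
      ContinuousAt (fun b => fun i : Fin n => itinerary b x i) a := fun x hx =>
    continuousAt_pi.2 fun i =>
      ContinuousAt.comp (f := fun b : UnitAddCircle => x + (i : ℕ) • b)
        (continuousAt_halfCode (hx i).1 (hx i).2)
        (by fun_prop)
  filter_upwards [Measure.quasiMeasurePreserving_fst.ae hae,
    Measure.quasiMeasurePreserving_snd.ae hae] with z h1 h2
  exact (continuous_of_discreteTopology (f := fun p : (Fin n → Bool) × (Fin n → Bool) =>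
    if D n p.1 p.2 then (1 : ℝ) else 0)).continuousAt.comp
      ((hseg _ h1).prodMk (hseg _ h2))

lemma measurable_expD_orbitMeasure {q : ℕ} (hq : q ≠ 0) (a : UnitAddCircle) :
    Measurable fun z : UnitAddCircle × UnitAddCircle =>
      expD D (orbitMeasure q (itinerary a z.1)) (orbitMeasure q (itinerary a z.2)) n := by
  simp only [expD_orbitMeasure D n hq, shift_iterate_itinerary]
  refine .const_mul (Finset.measurable_sum _ fun i _ => .const_mul
    (Finset.measurable_sum _ fun j _ => ?_) _) _
  exact (measurable_outputValue_itinerary D n a).comp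
    (f := fun z : UnitAddCircle × UnitAddCircle => (z.1 + i • a, z.2 + j • a)) (by fun_prop)

lemma expD_nonneg (ρ σ : Measure BinSeq) : 0 ≤ expD D ρ σ n :=
  integral_nonneg fun _ => outputValue_nonneg D n _ _

lemma expD_le_one (ρ σ : Measure BinSeq) [IsProbabilityMeasure ρ] [IsProbabilityMeasure σ] :
    expD D ρ σ n ≤ 1 := by
  rw [expD_eq_integral]
  refine (integral_mono (integrable_outputValue D n _) (integrable_const 1)
    fun _ => outputValue_le_one D n _ _).trans ?_
  simp

lemma integral_expD_orbitMeasure {q : ℕ} (hq : q ≠ 0) (a : UnitAddCircle) :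
    ∫ z : UnitAddCircle × UnitAddCircle,
      expD D (orbitMeasure q (itinerary a z.1)) (orbitMeasure q (itinerary a z.2)) n =
      expD D (rotationMeasure a) (rotationMeasure a) n := by
  simp only [expD_orbitMeasure D n hq, shift_iterate_itinerary, expD_rotationMeasure]
  have htrans : ∀ i j : ℕ, ∫ z : UnitAddCircle × UnitAddCircle,
      outputValue D n (itinerary a (z.1 + i • a)) (itinerary a (z.2 + j • a)) =
      ∫ z : UnitAddCircle × UnitAddCircle,
        outputValue D n (itinerary a z.1) (itinerary a z.2) := fun i j =>
    integral_add_right_eq_self (μ := (volume : Measure UnitAddCircle).prod (volume : Measure UnitAddCircle))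
      (fun z => outputValue D n (itinerary a z.1) (itinerary a z.2)) (i • a, j • a)
  have hint : ∀ i j : ℕ, Integrable fun z : UnitAddCircle × UnitAddCircle =>
      outputValue D n (itinerary a (z.1 + i • a)) (itinerary a (z.2 + j • a)) := fun i j =>
    .of_bound ((measurable_outputValue_itinerary D n a).comp
      (f := fun z : UnitAddCircle × UnitAddCircle => (z.1 + i • a, z.2 + j • a)) (by fun_prop)).aestronglyMeasurable 1
      (.of_forall fun _ => norm_outputValue_le_one D n _ _)
  rw [integral_const_mul, integral_finsetSum _ fun i _ =>
    (integrable_finsetSum _ fun j _ => hint i j).const_mul _]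
  simp only [integral_const_mul, integral_finsetSum _ fun j _ => hint _ j, htrans]
  have hq' : (q : ℝ) ≠ 0 := by exact_mod_cast hq
  simp [hq']

lemma addOrderOf_coe_eq_zero_of_irrational {t : ℝ} (ht : Irrational t) :
    addOrderOf (t : UnitAddCircle) = 0 := by
  refine addOrderOf_eq_zero_iff'.2 fun k hk h => ?_
  rw [← AddCircle.coe_nsmul, AddCircle.coe_eq_zero_iff] at h
  obtain ⟨m, hm⟩ := h
  have hne := (ht.natCast_mul hk.ne').ne_int m
  simp only [zsmul_eq_mul, mul_one, nsmul_eq_mul] at hm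
  exact hne hm.symm

lemma exists_odd_nsmul_eq_zero_of_isOpen {U : Set ℝ} (hU : IsOpen U) (hne : U.Nonempty) :
    ∃ t ∈ U, ∃ q : ℕ, Odd q ∧ q • (t : UnitAddCircle) = 0 := by
  obtain ⟨t, ht⟩ := hne
  obtain ⟨r, hr, hball⟩ := Metric.isOpen_iff.1 hU t ht
  obtain ⟨k, hk⟩ := exists_nat_one_div_lt hr
  have hq : (0 : ℝ) < 2 * k + 1 := by positivity
  refine ⟨⌊t * (2 * k + 1)⌋ / (2 * k + 1), hball ?_, 2 * k + 1, ⟨k, rfl⟩, ?_⟩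
  · have hle : 1 / (2 * (k : ℝ) + 1) ≤ 1 / (k + 1) := by
      gcongr
      linarith [(Nat.cast_nonneg k : (0 : ℝ) ≤ k)]
    have h1 : (⌊t * (2 * k + 1)⌋ : ℝ) / (2 * k + 1) ≤ t :=
      (div_le_iff₀ hq).2 (Int.floor_le _)
    have h2 : t - 1 / (2 * k + 1) ≤ (⌊t * (2 * k + 1)⌋ : ℝ) / (2 * k + 1) := by
      rw [le_div_iff₀ hq, sub_mul, one_div, inv_mul_cancel₀ hq.ne']
      linarith [Int.lt_floor_add_one (t * (2 * k + 1))]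
    rw [Metric.mem_ball, Real.dist_eq, abs_lt]
    constructor <;> linarith
  · rw [← AddCircle.coe_nsmul, AddCircle.coe_eq_zero_iff]
    refine ⟨⌊t * (2 * k + 1)⌋, ?_⟩
    simp only [zsmul_eq_mul, mul_one, nsmul_eq_mul]
    push_cast
    field_simp

end rotation

/-- At an odd torsion rotation `a`, the points `x` and `x + 1/2` have orbits with distinct
distributions, so an asymptotically correct procedure separates two independent samples of
`rotationMeasure a` with asymptotic probability at least `1/2`. -/
lemma not_eventually_expD_rotationMeasure_le
    (D : ∀ n : ℕ, (Fin n → Bool) → (Fin n → Bool) → Bool)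
    (hD : ∀ ρx ρy : Measure BinSeq,
      IsProbabilityMeasure ρx → IsProbabilityMeasure ρy →
      Ergodic shift ρx → Ergodic shift ρy →
      Filter.Tendsto (fun n => expD D ρx ρy n) Filter.atTop
        (nhds (if ρx = ρy then (0 : ℝ) else 1)))
    {q : ℕ} (hq : Odd q) {a : UnitAddCircle} (ha : q • a = 0) :
    ¬ ∀ᶠ n in atTop, expD D (rotationMeasure a) (rotationMeasure a) n ≤ 1 / 4 := by
  intro hle
  have hq0 : q ≠ 0 := hq.pos.ne'
  let ν : UnitAddCircle → Measure BinSeq := fun x => orbitMeasure q (itinerary a x)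
  have hν : ∀ x, IsProbabilityMeasure (ν x) := fun x => isProbabilityMeasure_orbitMeasure hq0 _
  have hνe : ∀ x, Ergodic shift (ν x) := fun x =>
    ergodic_orbitMeasure (by rw [shift_iterate_itinerary, ha, add_zero])
  let c : UnitAddCircle := ((1 / 2 : ℝ) : UnitAddCircle)
  let g : ℕ → UnitAddCircle × UnitAddCircle → ℝ := fun n z => expD D (ν z.1) (ν z.2) n
  have hgm : ∀ n, Measurable (g n) := fun n => measurable_expD_orbitMeasure D n hq0 a
  have hgm' : ∀ n, Measurable fun z : UnitAddCircle × UnitAddCircle => g n (z.1 + c, z.2) :=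
    fun n => (hgm n).comp (by fun_prop)
  have hg0 : ∀ n z, 0 ≤ g n z := fun n z => expD_nonneg D n _ _
  have hg1 : ∀ n z, ‖g n z‖ ≤ 1 := fun n z => by
    rw [Real.norm_of_nonneg (hg0 n z)]
    exact expD_le_one D n _ _
  have hgi : ∀ n, Integrable (g n) := fun n =>
    .of_bound (hgm n).aestronglyMeasurable 1 (.of_forall (hg1 n))
  have hgi' : ∀ n, Integrable fun z : UnitAddCircle × UnitAddCircle => g n (z.1 + c, z.2) :=
    fun n => .of_bound (hgm' n).aestronglyMeasurable 1 (.of_forall fun _ => hg1 n _)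
  have hint : ∀ n, ∫ z, g n z = expD D (rotationMeasure a) (rotationMeasure a) n := fun n =>
    integral_expD_orbitMeasure D n hq0 a
  have hint' : ∀ n, ∫ z : UnitAddCircle × UnitAddCircle, g n (z.1 + c, z.2) =
      expD D (rotationMeasure a) (rotationMeasure a) n := fun n => by
    rw [← hint n]
    have := integral_add_right_eq_self
      (μ := (volume : Measure UnitAddCircle).prod (volume : Measure UnitAddCircle)) (g n) (c, 0)
    simpa [Prod.add_def, Measure.volume_eq_prod] using this
  have hlim : ∀ z : UnitAddCircle × UnitAddCircle,
      Tendsto (fun n => min (g n z + g n (z.1 + c, z.2)) 1) atTop (𝓝 1) := by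
    intro z
    have h := ((hD _ _ (hν z.1) (hν z.2) (hνe z.1) (hνe z.2)).add
      (hD _ _ (hν (z.1 + c)) (hν z.2) (hνe (z.1 + c)) (hνe z.2))).min
      (tendsto_const_nhds (x := (1 : ℝ)))
    have hne : ν z.1 ≠ ν (z.1 + c) := orbitMeasure_itinerary_ne hq a z.1
    convert h using 2
    split_ifs with h1 h2
    · exact absurd (h1.trans h2.symm) hne
    all_goals norm_num
  have htend : Tendsto (fun n => ∫ z : UnitAddCircle × UnitAddCircle,
      min (g n z + g n (z.1 + c, z.2)) 1) atTop
      (𝓝 (∫ _ : UnitAddCircle × UnitAddCircle, (1 : ℝ))) := by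
    refine tendsto_integral_of_dominated_convergence (fun _ => 1)
      (fun n => (((hgm n).add (hgm' n)).min measurable_const).aestronglyMeasurable)
      (integrable_const _) (fun n => .of_forall fun z => ?_) (.of_forall hlim)
    rw [Real.norm_of_nonneg (le_min (add_nonneg (hg0 _ _) (hg0 _ _)) zero_le_one)]
    exact min_le_right _ _
  have hbound : ∀ᶠ n in atTop, ∫ z : UnitAddCircle × UnitAddCircle,
      min (g n z + g n (z.1 + c, z.2)) 1 ≤ 1 / 2 := by
    filter_upwards [hle] with n hn
    calc ∫ z : UnitAddCircle × UnitAddCircle, min (g n z + g n (z.1 + c, z.2)) 1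
        ≤ ∫ z : UnitAddCircle × UnitAddCircle, (g n z + g n (z.1 + c, z.2)) :=
          integral_mono (((hgi n).add (hgi' n)).inf (integrable_const 1))
            ((hgi n).add (hgi' n)) fun z => min_le_left _ _
      _ = expD D (rotationMeasure a) (rotationMeasure a) n +
          expD D (rotationMeasure a) (rotationMeasure a) n := by
          rw [integral_add (hgi n) (hgi' n), hint, hint']
      _ ≤ 1 / 2 := by linarith
  have := le_of_tendsto htend hbound
  norm_num at this

/-- No discrimination procedure is asymptotically correct for all stationary ergodic binary
processes. -/
theorem not_asymptoticallyCorrect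
    (D : ∀ n : ℕ, (Fin n → Bool) → (Fin n → Bool) → Bool) :
    ¬ ∀ ρx ρy : Measure BinSeq,
      IsProbabilityMeasure ρx → IsProbabilityMeasure ρy →
      Ergodic shift ρx → Ergodic shift ρy →
      Filter.Tendsto (fun n => expD D ρx ρy n) Filter.atTop
        (nhds (if ρx = ρy then (0 : ℝ) else 1)) := by
  intro hD
  let f : ℕ → ℝ → ℝ := fun n t =>
    expD D (rotationMeasure (t : UnitAddCircle)) (rotationMeasure (t : UnitAddCircle)) n
  have hf : ∀ n, Continuous (f n) := fun n =>
    (continuous_expD_rotationMeasure D n).comp (AddCircle.continuous_mk' 1)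
  let E : ℕ → Set ℝ := fun N => ⋂ n ≥ N, {t | f n t ≤ 1 / 4}
  have hE : ∀ N, IsClosed (E N) := fun N =>
    isClosed_biInter fun n _ => isClosed_le (hf n) continuous_const
  have hcover : {t : ℝ | Irrational t} ⊆ ⋃ N, E N := by
    intro t ht
    have he := ergodic_rotationMeasure (addOrderOf_coe_eq_zero_of_irrational ht)
    have h := hD _ _ inferInstance inferInstance he he
    rw [if_pos rfl] at h
    obtain ⟨N, hN⟩ := eventually_atTop.1 (h.eventually_le_const (show (0 : ℝ) < 1 / 4 by norm_num))
    exact Set.mem_iUnion.2 ⟨N, Set.mem_iInter₂.2 hN⟩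
  obtain ⟨t, ht⟩ :=
    (IsGδ.setOfPred_irrational.dense_iUnion_interior_of_closed dense_irrational hE hcover).nonempty
  obtain ⟨N, hN⟩ := Set.mem_iUnion.1 ht
  obtain ⟨s, hs, q, hq, hqs⟩ := exists_odd_nsmul_eq_zero_of_isOpen isOpen_interior ⟨t, hN⟩
  refine not_eventually_expD_rotationMeasure_le D hD hq hqs (eventually_atTop.2 ⟨N, fun n hn => ?_⟩)
  exact Set.mem_iInter₂.1 (interior_subset hs) n hn

/-- Fix `ε ∈ (0, 1/2)` and `δ ∈ [1/2, 1)`.  If a discrimination procedure `D` is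
asymptotically correct for the class of all stationary ergodic binary processes,
then there is a stationary ergodic binary process `ρ` such that, when both samples
are generated independently with distribution `ρ`, the sequence
`a_n = E[D_n((x_1,…,x_n),(y_1,…,y_n))]` satisfies
`liminf a_n ≤ ε + (1 − δ²)` and `limsup a_n ≥ (δ² − ε)/2`; in particular `a_n`
does not converge to `0`. -/
theorem discrimination_diverges_on_single_process
    (ε δ : ℝ) (hε : ε ∈ Set.Ioo (0 : ℝ) (1 / 2)) (hδ : δ ∈ Set.Ico (1 / 2 : ℝ) 1)
    (D : ∀ n : ℕ, (Fin n → Bool) → (Fin n → Bool) → Bool)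
    (hD : ∀ ρx ρy : Measure BinSeq,
      IsProbabilityMeasure ρx → IsProbabilityMeasure ρy →
      Ergodic shift ρx → Ergodic shift ρy →
      Filter.Tendsto (fun n => expD D ρx ρy n) Filter.atTop
        (nhds (if ρx = ρy then (0 : ℝ) else 1))) :
    ∃ ρ : Measure BinSeq,
      IsProbabilityMeasure ρ ∧ Ergodic shift ρ ∧
      Filter.liminf (fun n => expD D ρ ρ n) Filter.atTop ≤ ε + (1 - δ ^ 2) ∧
      (δ ^ 2 - ε) / 2 ≤ Filter.limsup (fun n => expD D ρ ρ n) Filter.atTop ∧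
      ¬ Filter.Tendsto (fun n => expD D ρ ρ n) Filter.atTop (nhds (0 : ℝ)) := by
  exact absurd hD (not_asymptoticallyCorrect D)
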